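/- arXiv:2306.09315 — 3 statements merged into one kernel-verified Lean document; each statement's English description precedes it below -/
import Mathlib

section
/- Let n ≥ 3 and let ε : {1,…,n−2} → {1,−1} be arbitrary. Let L be the (n−1)×(n−1) integer matrix with L_{ii} = 2 for all i, L_{i,i+1} = L_{i+1,i} = ε(i) for 1 ≤ i ≤ n−2, and all other entries 0. Then ℤ^{n−1}/(image of L as a ℤ-linear map) is isomorphic to ℤ/nℤ. -/
open Matrix

/-- The symmetric tridiagonal matrix with `2` on the diagonal and `ε 1, ε 2, …` next to it. -/
def signedPathMatrix (m : ℕ) (ε : ℕ → ℤ) : Matrix (Fin m) (Fin m) ℤ := fun i j =>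
  if i = j then 2
  else if (i : ℕ) + 1 = (j : ℕ) then ε ((i : ℕ) + 1)
  else if (j : ℕ) + 1 = (i : ℕ) then ε ((j : ℕ) + 1)
  else 0

lemma signedPathMatrix_transpose (m : ℕ) (ε : ℕ → ℤ) :
    (signedPathMatrix m ε)ᵀ = signedPathMatrix m ε := by
  ext i j
  simp only [transpose_apply, signedPathMatrix, Fin.ext_iff]
  split_ifs <;> first | rfl | omega

lemma signedPathMatrix_mulVec (m : ℕ) (ε Y : ℕ → ℤ) (i : Fin m) :
    (signedPathMatrix m ε *ᵥ fun j => Y j) i =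
      2 * Y i + (if (i : ℕ) + 1 < m then ε (i + 1) * Y (i + 1) else 0) +
        (if 0 < (i : ℕ) then ε i * Y (i - 1) else 0) := by
  have hi := i.isLt
  have key : ∀ j : Fin m, signedPathMatrix m ε i j * Y j =
      (if (i : ℕ) = (j : ℕ) then 2 * Y i else 0) +
      (if (i : ℕ) + 1 = (j : ℕ) then ε (i + 1) * Y (i + 1) else 0) +
      (if (i : ℕ) - 1 = (j : ℕ) then if 0 < (i : ℕ) then ε i * Y (i - 1) else 0 else 0) := by
    intro j
    simp only [signedPathMatrix, Fin.ext_iff]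
    grind
  simp only [mulVec, dotProduct, key]
  rw [Fin.sum_univ_eq_sum_range (fun j => (if (i : ℕ) = j then 2 * Y i else 0) +
      (if (i : ℕ) + 1 = j then ε (i + 1) * Y (i + 1) else 0) +
      (if (i : ℕ) - 1 = j then if 0 < (i : ℕ) then ε i * Y (i - 1) else 0 else 0)) m]
  simp only [Finset.sum_add_distrib, Finset.sum_ite_eq, Finset.mem_range]
  rw [if_pos hi, if_pos (show (i : ℕ) - 1 < m by omega)]

/-- A choice of signs switching every off-diagonal entry of `signedPathMatrix` to `-1`. -/
lemma exists_switching (m : ℕ) (ε : ℕ → ℤ)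
    (hε : ∀ k, k + 1 < m → ε (k + 1) = 1 ∨ ε (k + 1) = -1) :
    ∃ d : ℕ → ℤ, d 0 = 1 ∧ (∀ k < m, d k * d k = 1) ∧
      ∀ k, k + 1 < m → ε (k + 1) * d (k + 1) = -d k ∧ ε (k + 1) * d k = -d (k + 1) := by
  let d : ℕ → ℤ := fun k => Nat.rec 1 (fun k x => -(ε (k + 1) * x)) k
  have hd : ∀ k, d (k + 1) = -(ε (k + 1) * d k) := fun _ => rfl
  refine ⟨d, rfl, fun k => ?_, fun k hk => ?_⟩
  · induction k with
    | zero => exact fun _ => rfl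
    | succ k ih =>
      intro hk
      have := ih (by omega)
      rw [hd]
      rcases hε k hk with h | h <;> simp [h, this]
  · rw [hd]
    rcases hε k hk with h | h <;> simp [h]

lemma signedPathMatrix_mulVec_switching {m : ℕ} {ε d : ℕ → ℤ}
    (hd : ∀ k, k + 1 < m → ε (k + 1) * d (k + 1) = -d k ∧ ε (k + 1) * d k = -d (k + 1))
    {Z : ℕ → ℤ} (hZ : Z 0 = 0) (i : Fin m) :
    (signedPathMatrix m ε *ᵥ fun j => d j * Z (j + 1)) i =
      d i * (2 * Z (i + 1) - Z i - if (i : ℕ) + 1 < m then Z (i + 2) else 0) := by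
  rw [signedPathMatrix_mulVec m ε (fun j => d j * Z (j + 1))]
  obtain ⟨i, hi⟩ := i
  have h₁ : (if i + 1 < m then ε (i + 1) * (d (i + 1) * Z (i + 1 + 1)) else 0) =
      -(d i * if i + 1 < m then Z (i + 2) else 0) := by
    split_ifs with h
    · rw [← mul_assoc, (hd i h).1, neg_mul]
    · simp
  have h₂ : (if 0 < i then ε i * (d (i - 1) * Z (i - 1 + 1)) else 0) = -(d i * Z i) := by
    cases i with
    | zero => simp [hZ]
    | succ k => simp [← mul_assoc, (hd k hi).2]
  simp only [h₁, h₂]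
  ring

lemma sum_range_sub_partial_sum (w : ℕ → ℤ) (a : ℤ) (k : ℕ) :
    ∑ j ∈ Finset.range k, (a - ∑ i ∈ Finset.range j, w i) =
      k * (a - ∑ i ∈ Finset.range k, w i) + ∑ i ∈ Finset.range k, ((i : ℤ) + 1) * w i := by
  induction k with
  | zero => simp
  | succ k ih =>
    rw [Finset.sum_range_succ, ih, Finset.sum_range_succ _ k, Finset.sum_range_succ _ k]
    push_cast
    ring

lemma mem_range_signedPathMatrix_iff {m : ℕ} {ε d : ℕ → ℤ} (hd₁ : ∀ k < m, d k * d k = 1)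
    (hd : ∀ k, k + 1 < m → ε (k + 1) * d (k + 1) = -d k ∧ ε (k + 1) * d k = -d (k + 1))
    (x : Fin m → ℤ) :
    x ∈ LinearMap.range (toLin' (signedPathMatrix m ε)) ↔
      ((m + 1 : ℕ) : ℤ) ∣ x ⬝ᵥ fun i => d i * (((i : ℕ) + 1 : ℕ) : ℤ) := by
  constructor
  · rintro ⟨y, rfl⟩
    rw [toLin'_apply, dotProduct_comm, dotProduct_mulVec, ← mulVec_transpose,
      signedPathMatrix_transpose]
    refine Finset.dvd_sum fun i _ => Dvd.dvd.mul_right ?_ _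
    rw [signedPathMatrix_mulVec_switching hd (Z := fun k => (k : ℤ)) rfl]
    refine Dvd.dvd.mul_left ?_ _
    have := i.isLt
    split_ifs with h
    · convert dvd_zero _
      push_cast
      ring
    · refine dvd_of_eq ?_
      push_cast
      omega
  · rintro ⟨c, hc⟩
    let w : ℕ → ℤ := fun i => if h : i < m then d i * x ⟨i, h⟩ else 0
    have hw : ∀ i : Fin m, w i = d i * x i := fun i => by simp [w]
    have hwm : w m = 0 := by simp [w]
    have hsum : ∑ i ∈ Finset.range (m + 1), ((i : ℤ) + 1) * w i = ((m + 1 : ℕ) : ℤ) * c := by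
      rw [Finset.sum_range_succ, hwm, mul_zero, add_zero, ← hc,
        ← Fin.sum_univ_eq_sum_range (fun i => ((i : ℤ) + 1) * w i), dotProduct]
      refine Finset.sum_congr rfl fun i _ => ?_
      rw [hw]
      push_cast
      ring
    let a : ℤ := ∑ i ∈ Finset.range (m + 1), w i - c
    let Z : ℕ → ℤ := fun k => ∑ j ∈ Finset.range k, (a - ∑ i ∈ Finset.range j, w i)
    have hZm : Z (m + 1) = 0 := by
      simp only [Z]
      rw [sum_range_sub_partial_sum, hsum]
      simp only [a]
      ring
    refine ⟨fun j => d j * Z (j + 1), ?_⟩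
    ext i
    rw [toLin'_apply, signedPathMatrix_mulVec_switching hd (Z := Z) rfl]
    have hlast : (if (i : ℕ) + 1 < m then Z (i + 2) else 0) = Z (i + 2) := by
      split_ifs with h
      · rfl
      · rw [← hZm, show (i : ℕ) + 2 = m + 1 by omega]
    have hrec : 2 * Z (i + 1) - Z i - Z (i + 2) = w i := by
      simp only [Z, Finset.sum_range_succ]
      ring
    rw [hlast, hrec, hw, ← mul_assoc, hd₁ i i.isLt, one_mul]

/-- Proposition `Cyclecrit`: the critical group of any signed cycle on `n` vertices is
`ℤ/nℤ`.  Here `L` is the reduced signed Laplacian: tridiagonal with `2` on the diagonal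
and arbitrary signs `ε(i) ∈ {±1}` on the off-diagonals. -/
theorem stmt3 (n : ℕ) (hn : 3 ≤ n) (ε : ℕ → ℤ)
    (hε : ∀ i, 1 ≤ i → i ≤ n - 2 → ε i = 1 ∨ ε i = -1)
    (L : Matrix (Fin (n - 1)) (Fin (n - 1)) ℤ)
    (hL : ∀ i j : Fin (n - 1), L i j =
      if i = j then 2
      else if (i : ℕ) + 1 = (j : ℕ) then ε ((i : ℕ) + 1)
      else if (j : ℕ) + 1 = (i : ℕ) then ε ((j : ℕ) + 1)
      else 0) :
    Nonempty (((Fin (n - 1) → ℤ) ⧸ LinearMap.range (Matrix.toLin' L)) ≃+ ZMod n) := by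
  obtain ⟨m, rfl⟩ : ∃ m, n = m + 1 := ⟨n - 1, by omega⟩
  obtain rfl : L = signedPathMatrix m ε := Matrix.ext hL
  obtain ⟨d, hd₀, hd₁, hd⟩ := exists_switching m ε fun k hk => hε (k + 1) (by omega) (by omega)
  let f : (Fin m → ℤ) →ₗ[ℤ] ZMod (m + 1) := (Int.castAddHom (ZMod (m + 1))).toIntLinearMap ∘ₗ
    Fintype.linearCombination ℤ fun i : Fin m => d i * (((i : ℕ) + 1 : ℕ) : ℤ)
  have hf : ∀ x, f x = ((x ⬝ᵥ fun i => d i * (((i : ℕ) + 1 : ℕ) : ℤ) : ℤ) : ZMod (m + 1)) :=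
    fun _ => rfl
  have hker : LinearMap.range (toLin' (signedPathMatrix m ε)) = LinearMap.ker f := by
    ext x
    rw [mem_range_signedPathMatrix_iff hd₁ hd, LinearMap.mem_ker, hf,
      ZMod.intCast_zmod_eq_zero_iff_dvd]
  have hsurj : Function.Surjective f := by
    intro z
    obtain ⟨t, rfl⟩ := ZMod.intCast_surjective z
    refine ⟨Pi.single ⟨0, by omega⟩ t, ?_⟩
    rw [hf, single_dotProduct]
    simp [hd₀]
  exact ⟨((Submodule.quotEquivOfEq _ _ hker).trans
    (f.quotKerEquivOfSurjective hsurj)).toAddEquiv⟩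
end

section
/- Let m ≥ 1. Let L be the 2m×2m integer matrix with L_{ii} = 2, L_{i,i+1} = L_{i+1,i} = 1, other entries 0, and let M be the 2m×2m integer matrix with M_{ii} = 2, M_{i,i+1} = M_{i+1,i} = −1, other entries 0. Then the vector e = L·M⁻¹·𝟙 (where 𝟙 is the all-ones vector, computation over ℚ) has integer entries, and the map c ↦ e + c is a bijection from the set of z-superstable configurations of the chip-firing pair (L, M) onto the set of critical configurations of the pair (L, M). -/
open Matrix

/-- `c ∈ S⁺` for the chip-firing pair `(L, M)`: every entry of `M·L⁻¹·c` (over ℚ) is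
nonnegative. -/
def cfValid {n : ℕ} (L M : Matrix (Fin n) (Fin n) ℤ) (c : Fin n → ℤ) : Prop :=
  ∀ i, 0 ≤ (((M.map (Int.cast : ℤ → ℚ)) * (L.map (Int.cast : ℤ → ℚ))⁻¹).mulVec
    (fun j => (c j : ℚ))) i

/-- `c` is stable for the pair `(L, M)`: no single site can be legally fired. -/
def cfStable {n : ℕ} (L M : Matrix (Fin n) (Fin n) ℤ) (c : Fin n → ℤ) : Prop :=
  ∀ i, ¬ cfValid L M (c - L.mulVec (Pi.single i 1))

/-- There is a legal firing sequence from `d` to `c`: firing the sites in the list `l`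
one at a time, every intermediate configuration is valid and the final result is `c`. -/
def cfLegal {n : ℕ} (L M : Matrix (Fin n) (Fin n) ℤ) (d c : Fin n → ℤ) : Prop :=
  ∃ l : List (Fin n),
    (∀ t ≤ l.length, cfValid L M (d - L.mulVec (fun i => ((l.take t).count i : ℤ)))) ∧
    c = d - L.mulVec (fun i => (l.count i : ℤ))

/-- `c` is reachable for the pair `(L, M)`: there is a valid configuration `d` from which
every site can be fired, together with a legal firing sequence from `d` to `c`. -/
def cfReachable {n : ℕ} (L M : Matrix (Fin n) (Fin n) ℤ) (c : Fin n → ℤ) : Prop :=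
  ∃ d : Fin n → ℤ, cfValid L M d ∧
    (∀ i, cfValid L M (d - L.mulVec (Pi.single i 1))) ∧ cfLegal L M d c

/-- `c` is critical for the pair `(L, M)`: valid, stable and reachable. -/
def cfCritical {n : ℕ} (L M : Matrix (Fin n) (Fin n) ℤ) (c : Fin n → ℤ) : Prop :=
  cfValid L M c ∧ cfStable L M c ∧ cfReachable L M c

/-- `c` is z-superstable for the pair `(L, M)`: `c` is valid and for every nonzero
nonnegative integer vector `z`, `c - L·z` is not valid. -/
def cfZSuperstable {n : ℕ} (L M : Matrix (Fin n) (Fin n) ℤ) (c : Fin n → ℤ) : Prop :=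
  cfValid L M c ∧
    ∀ z : Fin n → ℤ, (∀ i, 0 ≤ z i) → z ≠ 0 → ¬ cfValid L M (c - L.mulVec z)

/-- The configuration `c` in the coordinates `M·L⁻¹·c`, in which validity is nonnegativity and
firing the site `i` subtracts the `i`-th column of `M`. -/
noncomputable def cfCoord {n : ℕ} (L M : Matrix (Fin n) (Fin n) ℤ) (c : Fin n → ℤ) : Fin n → ℚ :=
  ((M.map (Int.cast : ℤ → ℚ)) * (L.map (Int.cast : ℤ → ℚ))⁻¹).mulVec (fun j => (c j : ℚ))

theorem cfValid_iff_cfCoord {n : ℕ} (L M : Matrix (Fin n) (Fin n) ℤ) (c : Fin n → ℤ) :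
    cfValid L M c ↔ ∀ i, 0 ≤ cfCoord L M c i := Iff.rfl

theorem intCast_mulVec {n : ℕ} (A : Matrix (Fin n) (Fin n) ℤ) (u : Fin n → ℤ) :
    (fun i => ((A.mulVec u i : ℤ) : ℚ)) =
      (A.map (Int.cast : ℤ → ℚ)).mulVec (fun j => (u j : ℚ)) := by
  funext i
  simp [Matrix.mulVec, dotProduct]

theorem cfCoord_add {n : ℕ} (L M : Matrix (Fin n) (Fin n) ℤ) (c d : Fin n → ℤ) (i : Fin n) :
    cfCoord L M (c + d) i = cfCoord L M c i + cfCoord L M d i := by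
  have : (fun j => (((c + d) j : ℤ) : ℚ)) = (fun j => (c j : ℚ)) + fun j => (d j : ℚ) := by
    funext j
    simp
  rw [cfCoord, this, Matrix.mulVec_add, Pi.add_apply]
  rfl

theorem cfCoord_mulVec {n : ℕ} (L M : Matrix (Fin n) (Fin n) ℤ)
    (hdet : IsUnit (L.map (Int.cast : ℤ → ℚ)).det) (u : Fin n → ℤ) (i : Fin n) :
    cfCoord L M (L.mulVec u) i = (M.mulVec u i : ℤ) := by
  rw [show ((M.mulVec u i : ℤ) : ℚ) = _ from congrFun (intCast_mulVec M u) i, cfCoord, intCast_mulVec, Matrix.mulVec_mulVec, Matrix.mul_assoc,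
    Matrix.nonsing_inv_mul _ hdet, Matrix.mul_one]

theorem cfCoord_sub_mulVec {n : ℕ} (L M : Matrix (Fin n) (Fin n) ℤ)
    (hdet : IsUnit (L.map (Int.cast : ℤ → ℚ)).det) (c u : Fin n → ℤ) (i : Fin n) :
    cfCoord L M (c - L.mulVec u) i = cfCoord L M c i - (M.mulVec u i : ℤ) := by
  have h := cfCoord_add L M (c - L.mulVec u) (L.mulVec u) i
  rw [sub_add_cancel, cfCoord_mulVec L M hdet] at h
  linarith

/-- An off-diagonally nonpositive matrix with diagonal `2` sends a nonnegative vector vanishing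
at `i` to a vector nonpositive at `i`. -/
theorem mulVec_nonpos_of_apply_eq_zero {n : ℕ} (M : Matrix (Fin n) (Fin n) ℤ)
    (hoff : ∀ i j, i ≠ j → M i j ≤ 0) (z : Fin n → ℤ) (hz : ∀ i, 0 ≤ z i) (i : Fin n)
    (hi : z i = 0) : M.mulVec z i ≤ 0 := by
  rw [Matrix.mulVec, dotProduct]
  refine Finset.sum_nonpos fun j _ => ?_
  by_cases h : i = j
  · subst h
    simp [hi]
  · exact mul_nonpos_of_nonpos_of_nonneg (hoff i j h) (hz j)

theorem count_cons_eq_single_add {n : ℕ} (i : Fin n) (l : List (Fin n)) :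
    (fun j => (((i :: l).count j : ℕ) : ℤ)) = Pi.single i 1 + fun j => ((l.count j : ℕ) : ℤ) := by
  funext j
  by_cases h : j = i
  · subst h
    simp [add_comm]
  · simp [h, Ne.symm h]

theorem mulVec_count_cons {n : ℕ} (A : Matrix (Fin n) (Fin n) ℤ) (i : Fin n)
    (l : List (Fin n)) :
    A.mulVec (fun j => (((i :: l).count j : ℕ) : ℤ)) =
      A.mulVec (Pi.single i 1) + A.mulVec (fun j => ((l.count j : ℕ) : ℤ)) := by
  rw [count_cons_eq_single_add, Matrix.mulVec_add]

theorem mulVec_single_one_apply {n : ℕ} (A : Matrix (Fin n) (Fin n) ℤ) (i j : Fin n) :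
    A.mulVec (Pi.single i 1) j = A j i := by
  simp

theorem cfLegal_refl {n : ℕ} {L M : Matrix (Fin n) (Fin n) ℤ} {c : Fin n → ℤ}
    (hc : cfValid L M c) : cfLegal L M c c := by
  have h0 : L.mulVec (fun _ => (0 : ℤ)) = 0 := Matrix.mulVec_zero L
  refine ⟨[], ?_, ?_⟩
  · intro t _
    simpa [h0] using hc
  · simp [h0]

theorem cfLegal_of_fire {n : ℕ} {L M : Matrix (Fin n) (Fin n) ℤ} {c d : Fin n → ℤ}
    (hd : cfValid L M d) (i : Fin n) (h : cfLegal L M (d - L.mulVec (Pi.single i 1)) c) :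
    cfLegal L M d c := by
  obtain ⟨l, hl, hc⟩ := h
  refine ⟨i :: l, ?_, ?_⟩
  · rintro (_ | t) ht
    · have h0 : L.mulVec (fun _ => (0 : ℤ)) = 0 := Matrix.mulVec_zero L
      simpa [h0] using hd
    · rw [List.take_succ_cons, mulVec_count_cons, ← sub_sub]
      exact hl t (by simpa using ht)
  · rw [mulVec_count_cons, ← sub_sub]
    exact hc

/-- If the coordinates of `c + L·v` with `v ≥ 0` are below `2` and a legal firing sequence firing
every site `i` at least `v i` times ends at `c`, then `v = 0`. -/
theorem eq_zero_of_le_count {n : ℕ} (L M : Matrix (Fin n) (Fin n) ℤ)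
    (hdet : IsUnit (L.map (Int.cast : ℤ → ℚ)).det) (hdiag : ∀ i, M i i = 2)
    (hoff : ∀ i j, i ≠ j → M i j ≤ 0) (c v : Fin n → ℤ) (hv : ∀ i, 0 ≤ v i)
    (hlt : ∀ i, cfCoord L M c i + (M.mulVec v i : ℤ) < 2) (l : List (Fin n)) :
    ∀ d : Fin n → ℤ,
      (∀ t ≤ l.length, cfValid L M (d - L.mulVec (fun i => ((l.take t).count i : ℤ)))) →
      c = d - L.mulVec (fun i => (l.count i : ℤ)) →
      (∀ i, v i ≤ (l.count i : ℤ)) → v = 0 := by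
  induction l with
  | nil =>
    intro d _ _ hle
    funext i
    exact le_antisymm (by simpa using hle i) (hv i)
  | cons i l ih =>
    intro d hval hc hle
    by_cases hl : ∀ j, v j ≤ (l.count j : ℤ)
    · refine ih (d - L.mulVec (Pi.single i 1)) ?_ ?_ hl
      · intro t ht
        have := hval (t + 1) (by simpa using ht)
        rwa [List.take_succ_cons, mulVec_count_cons, ← sub_sub] at this
      · rwa [mulVec_count_cons, ← sub_sub] at hc
    · exfalso
      push Not at hl
      obtain ⟨j, hj⟩ := hl
      have hji : j = i := by
        by_contra hne
        have := hle j
        rw [List.count_cons_of_ne (Ne.symm hne)] at this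
        omega
      subst hji
      have hvj : ((j :: l).count j : ℤ) = v j := by
        have := hle j
        simp only [List.count_cons_self] at this ⊢
        push_cast at this ⊢
        omega
      have h1 := (cfValid_iff_cfCoord L M _).1 (hval 1 (by simp)) j
      rw [show List.take 1 (j :: l) = [j] by simp, mulVec_count_cons] at h1
      have h0 : L.mulVec (fun _ => (0 : ℤ)) = 0 := Matrix.mulVec_zero L
      simp only [List.count_nil, Nat.cast_zero, h0, add_zero] at h1
      rw [cfCoord_sub_mulVec L M hdet, mulVec_single_one_apply, hdiag] at h1
      have h2 := cfCoord_sub_mulVec L M hdet d (fun i => (((j :: l).count i : ℕ) : ℤ)) j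
      rw [← hc] at h2
      have h3 := mulVec_nonpos_of_apply_eq_zero M hoff
        ((fun i => (((j :: l).count i : ℕ) : ℤ)) - v)
        (fun i => sub_nonneg.2 (hle i)) j (sub_eq_zero.2 hvj)
      rw [Matrix.mulVec_sub, Pi.sub_apply] at h3
      have h4 : ((M.mulVec (fun i => (((j :: l).count i : ℕ) : ℤ)) j : ℤ) : ℚ)
          ≤ (M.mulVec v j : ℤ) := by exact_mod_cast (by linarith)
      have h5 := hlt j
      push_cast at h1
      linarith

/-- A configuration whose coordinates lie in `[1, ∞)` is reached from any valid configuration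
`c + L·u` with `u ≥ 0`. -/
theorem cfLegal_add_mulVec {n : ℕ} (L M : Matrix (Fin n) (Fin n) ℤ)
    (hdet : IsUnit (L.map (Int.cast : ℤ → ℚ)).det) (hdiag : ∀ i, M i i = 2)
    (hoff : ∀ i j, i ≠ j → M i j ≤ 0)
    (hpos : ∀ z : Fin n → ℤ, (∀ i, 0 ≤ M.mulVec z i) → ∀ i, 0 ≤ z i)
    (c : Fin n → ℤ) (hc : ∀ i, 1 ≤ cfCoord L M c i) (s : ℕ) :
    ∀ u : Fin n → ℤ, (∀ i, 0 ≤ u i) → ∑ i, u i = s → cfValid L M (c + L.mulVec u) →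
      cfLegal L M (c + L.mulVec u) c := by
  induction s with
  | zero =>
    intro u hu hs hval
    have hu0 : u = 0 := by
      funext i
      exact (Finset.sum_eq_zero_iff_of_nonneg (fun i _ => hu i)).1 (by simpa using hs) i
        (Finset.mem_univ i)
    subst hu0
    rw [Matrix.mulVec_zero, add_zero] at hval ⊢
    exact cfLegal_refl hval
  | succ s ih =>
    intro u hu hs hval
    have hex : ∃ i, 0 < u i ∧ 1 ≤ M.mulVec u i := by
      by_contra hcon
      push Not at hcon
      have hle : ∀ i, M.mulVec u i ≤ 0 := by
        intro i
        rcases (hu i).lt_or_eq with h | h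
        · have := hcon i h
          omega
        · exact mulVec_nonpos_of_apply_eq_zero M hoff u hu i h.symm
      have hneg := hpos (-u) (fun i => by
        rw [Matrix.mulVec_neg, Pi.neg_apply]
        linarith [hle i])
      have : ∑ i, u i ≤ 0 := Finset.sum_nonpos fun i _ => by
        have := hneg i
        simp only [Pi.neg_apply] at this
        linarith
      rw [hs] at this
      push_cast at this
      omega
    obtain ⟨i, hui, hMi⟩ := hex
    have heq : c + L.mulVec u - L.mulVec (Pi.single i 1) =
        c + L.mulVec (u - Pi.single i 1) := by
      rw [Matrix.mulVec_sub, add_sub_assoc]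
    refine cfLegal_of_fire hval i ?_
    rw [heq]
    refine ih _ ?_ ?_ ?_
    · intro j
      by_cases h : j = i
      · subst h
        simp
        omega
      · simpa [h] using hu j
    · simp [Finset.sum_sub_distrib, hs]
    · rw [← heq, cfValid_iff_cfCoord]
      intro j
      rw [cfCoord_sub_mulVec L M hdet, mulVec_single_one_apply]
      by_cases h : j = i
      · subst h
        rw [hdiag, cfCoord_add, cfCoord_mulVec L M hdet]
        have h1 : (1 : ℚ) ≤ (M.mulVec u j : ℤ) := by exact_mod_cast hMi
        have h2 := hc j
        push_cast
        linarith
      · have h1 : ((M j i : ℤ) : ℚ) ≤ 0 := by exact_mod_cast hoff j i h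
        have h2 := (cfValid_iff_cfCoord L M _).1 hval j
        linarith

theorem cfZSuperstable_iff {n : ℕ} (L M : Matrix (Fin n) (Fin n) ℤ)
    (hdet : IsUnit (L.map (Int.cast : ℤ → ℚ)).det)
    (hpos : ∀ z : Fin n → ℤ, (∀ i, 0 ≤ M.mulVec z i) → ∀ i, 0 ≤ z i)
    (hfloor : ∀ c, ∃ z : Fin n → ℤ, ∀ i, M.mulVec z i = ⌊cfCoord L M c i⌋) (c : Fin n → ℤ) :
    cfZSuperstable L M c ↔ ∀ i, 0 ≤ cfCoord L M c i ∧ cfCoord L M c i < 1 := by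
  constructor
  · rintro ⟨hval, hss⟩ i
    refine ⟨hval i, ?_⟩
    obtain ⟨z, hz⟩ := hfloor c
    have hz0 : z = 0 := by
      by_contra hne
      refine hss z (hpos z fun i => ?_) hne ?_
      · rw [hz]
        exact Int.floor_nonneg.2 (hval i)
      · intro i
        change 0 ≤ cfCoord L M _ i
        rw [cfCoord_sub_mulVec L M hdet, hz]
        linarith [Int.floor_le (cfCoord L M c i)]
    have h := hz i
    rw [hz0, Matrix.mulVec_zero, Pi.zero_apply] at h
    have h1 := Int.lt_floor_add_one (cfCoord L M c i)
    rw [← h] at h1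
    simpa using h1
  · intro h
    refine ⟨fun i => (h i).1, fun z hz hne hval => hne ?_⟩
    have hneg := hpos (-z) (fun i => by
      have h1 := (cfValid_iff_cfCoord L M _).1 hval i
      rw [cfCoord_sub_mulVec L M hdet] at h1
      have h2 : ((M.mulVec z i : ℤ) : ℚ) < 1 := by linarith [(h i).2]
      have h3 : M.mulVec z i < 1 := by exact_mod_cast h2
      rw [Matrix.mulVec_neg, Pi.neg_apply]
      omega)
    funext i
    have := hneg i
    simp only [Pi.neg_apply] at this
    exact le_antisymm (neg_nonneg.1 this) (hz i)

theorem cfCritical_iff {n : ℕ} (L M : Matrix (Fin n) (Fin n) ℤ)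
    (hdet : IsUnit (L.map (Int.cast : ℤ → ℚ)).det) (hdiag : ∀ i, M i i = 2)
    (hoff : ∀ i j, i ≠ j → M i j ≤ 0)
    (hpos : ∀ z : Fin n → ℤ, (∀ i, 0 ≤ M.mulVec z i) → ∀ i, 0 ≤ z i)
    (hfloor : ∀ c, ∃ z : Fin n → ℤ, ∀ i, M.mulVec z i = ⌊cfCoord L M c i⌋)
    (w : Fin n → ℤ) (hw : ∀ i, M.mulVec w i = 1) (c : Fin n → ℤ) :
    cfCritical L M c ↔ ∀ i, 1 ≤ cfCoord L M c i ∧ cfCoord L M c i < 2 := by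
  constructor
  · rintro ⟨hval, hst, d, hd, hdf, l, hl, hc⟩
    rw [cfValid_iff_cfCoord] at hval
    have hlt : ∀ i, cfCoord L M c i < 2 := by
      intro i
      by_contra hge
      push Not at hge
      refine hst i fun j => ?_
      change 0 ≤ cfCoord L M _ j
      rw [cfCoord_sub_mulVec L M hdet, mulVec_single_one_apply]
      by_cases h : j = i
      · subst h
        rw [hdiag]
        push_cast
        linarith
      · have h1 : ((M j i : ℤ) : ℚ) ≤ 0 := by exact_mod_cast hoff j i h
        linarith [hval j]
    obtain ⟨z, hz⟩ := hfloor c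
    have hv : ∀ i, 0 ≤ (w - z) i := hpos _ fun i => by
      rw [Matrix.mulVec_sub, Pi.sub_apply, hw, hz]
      have : ⌊cfCoord L M c i⌋ < 2 := Int.floor_lt.2 (by exact_mod_cast hlt i)
      omega
    have hle : ∀ i, 0 ≤ ((fun i => (l.count i : ℤ)) - (w - z)) i := hpos _ fun i => by
      have h1 := (cfValid_iff_cfCoord L M _).1 (hdf i) i
      rw [cfCoord_sub_mulVec L M hdet, mulVec_single_one_apply, hdiag] at h1
      have h2 := cfCoord_sub_mulVec L M hdet d (fun i => (l.count i : ℤ)) i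
      rw [← hc] at h2
      have h3 := Int.lt_floor_add_one (cfCoord L M c i)
      rw [← hz] at h3
      have h4 : ((1 : ℤ) : ℚ) < (M.mulVec z i + 1 + M.mulVec (fun i => (l.count i : ℤ)) i : ℤ) := by
        push_cast at h1 ⊢
        linarith
      rw [Matrix.mulVec_sub, Matrix.mulVec_sub, Pi.sub_apply, Pi.sub_apply, hw]
      have h5 := Int.cast_lt.1 h4
      omega
    have hv0 := eq_zero_of_le_count L M hdet hdiag hoff c (w - z) hv (fun i => by
      rw [Matrix.mulVec_sub, Pi.sub_apply, hw, hz]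
      push_cast
      linarith [Int.lt_floor_add_one (cfCoord L M c i)]) l d hl hc
      (fun i => by
        have := hle i
        simp only [Pi.sub_apply] at this ⊢
        linarith)
    have hwz : w = z := sub_eq_zero.1 hv0
    intro i
    refine ⟨?_, hlt i⟩
    have h1 := Int.floor_le (cfCoord L M c i)
    rw [← hz, ← hwz, hw] at h1
    simpa using h1
  · intro h
    have hval : cfValid L M c := fun i => by
      change 0 ≤ cfCoord L M c i
      linarith [(h i).1]
    have hco : ∀ i, cfCoord L M (c + L.mulVec w) i = cfCoord L M c i + 1 := fun i => by
      rw [cfCoord_add, cfCoord_mulVec L M hdet, hw, Int.cast_one]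
    have hd : cfValid L M (c + L.mulVec w) := fun i => by
      change 0 ≤ cfCoord L M _ i
      rw [hco]
      linarith [(h i).1]
    have hw0 : ∀ i, 0 ≤ w i := hpos w fun i => by simp [hw]
    refine ⟨hval, ?_, c + L.mulVec w, hd, ?_, ?_⟩
    · intro i hv
      have h1 := (cfValid_iff_cfCoord L M _).1 hv i
      rw [cfCoord_sub_mulVec L M hdet, mulVec_single_one_apply, hdiag] at h1
      push_cast at h1
      linarith [(h i).2]
    · intro i j
      change 0 ≤ cfCoord L M _ j
      rw [cfCoord_sub_mulVec L M hdet, mulVec_single_one_apply, hco]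
      by_cases hji : j = i
      · subst hji
        rw [hdiag]
        push_cast
        linarith [(h j).1]
      · have h1 : ((M j i : ℤ) : ℚ) ≤ 0 := by exact_mod_cast hoff j i hji
        linarith [(h j).1]
    · exact cfLegal_add_mulVec L M hdet hdiag hoff hpos c (fun i => (h i).1)
        (∑ i, w i).toNat w hw0
        (Int.toNat_of_nonneg (Finset.sum_nonneg fun i _ => hw0 i)).symm hd

/-- The vector `v` placed at positions `1, …, n` of a sequence that is zero elsewhere. -/
def zeroExtend {R : Type*} [Zero R] {n : ℕ} (v : Fin n → R) (k : ℕ) : R :=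
  if h : 1 ≤ k ∧ k ≤ n then v ⟨k - 1, by omega⟩ else 0

theorem zeroExtend_zero {R : Type*} [Zero R] {n : ℕ} (v : Fin n → R) : zeroExtend v 0 = 0 := by
  simp [zeroExtend]

theorem zeroExtend_succ {R : Type*} [Zero R] {n : ℕ} (v : Fin n → R) (i : Fin n) :
    zeroExtend v (i + 1) = v i := by
  simp [zeroExtend]

theorem zeroExtend_last {R : Type*} [Zero R] {n : ℕ} (v : Fin n → R) :
    zeroExtend v (n + 1) = 0 := by
  simp [zeroExtend]

theorem tridiagonal_mulVec {R : Type*} [CommRing R] {n : ℕ} (a : R)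
    (A : Matrix (Fin n) (Fin n) R)
    (hA : ∀ i j : Fin n, A i j =
      if i = j then 2
      else if (i : ℕ) + 1 = (j : ℕ) ∨ (j : ℕ) + 1 = (i : ℕ) then a
      else 0)
    (Z : ℕ → R) (h0 : Z 0 = 0) (hn : Z (n + 1) = 0) (i : Fin n) :
    A.mulVec (fun j => Z (j + 1)) i = 2 * Z (i + 1) + a * (Z i + Z (i + 2)) := by
  have hterm : ∀ j : Fin n, A i j * Z (j + 1) =
      (fun k : ℕ => (if k = (i : ℕ) then 2 * Z (k + 1) else 0) +
        ((if k = (i : ℕ) + 1 then a * Z (k + 1) else 0) +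
        (if k + 1 = (i : ℕ) then a * Z (k + 1) else 0))) j := by
    intro j
    rw [hA]
    by_cases h1 : i = j
    · subst h1
      simp
    · have h1' : (j : ℕ) ≠ i := fun h => h1 (Fin.ext h.symm)
      by_cases h2 : (i : ℕ) + 1 = j
      · have : ¬ (j : ℕ) + 1 = i := by omega
        simp [h1, h1', h2, this]
      · have h2' : ¬ (j : ℕ) = i + 1 := fun h => h2 h.symm
        by_cases h3 : (j : ℕ) + 1 = i <;> simp [h1, h1', h2, h2', h3]
  have hi := i.isLt
  rw [Matrix.mulVec, dotProduct, Finset.sum_congr rfl (fun j _ => hterm j),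
    Fin.sum_univ_eq_sum_range (fun k : ℕ => (if k = (i : ℕ) then 2 * Z (k + 1) else 0) +
        ((if k = (i : ℕ) + 1 then a * Z (k + 1) else 0) +
        (if k + 1 = (i : ℕ) then a * Z (k + 1) else 0))) n, Finset.sum_add_distrib, Finset.sum_add_distrib]
  have s1 : ∑ k ∈ Finset.range n, (if k = (i : ℕ) then 2 * Z (k + 1) else 0)
      = 2 * Z (i + 1) := by
    simp
  have s2 : ∑ k ∈ Finset.range n, (if k = (i : ℕ) + 1 then a * Z (k + 1) else 0)
      = a * Z (i + 2) := by
    rw [Finset.sum_ite_eq']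
    split_ifs with h
    · rfl
    · rw [Finset.mem_range] at h
      rw [show (i : ℕ) + 2 = n + 1 by omega, hn, mul_zero]
  have s3 : ∑ k ∈ Finset.range n, (if k + 1 = (i : ℕ) then a * Z (k + 1) else 0)
      = a * Z i := by
    rcases hk : (i : ℕ) with _ | p
    · simp [h0]
    · simp only [Nat.add_right_cancel_iff]
      rw [Finset.sum_ite_eq', if_pos (Finset.mem_range.2 (by omega))]
  rw [s1, s2, s3]
  ring

theorem tridiagonal_mulVec_zeroExtend {R : Type*} [CommRing R] {n : ℕ} (a : R)
    (A : Matrix (Fin n) (Fin n) R)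
    (hA : ∀ i j : Fin n, A i j =
      if i = j then 2
      else if (i : ℕ) + 1 = (j : ℕ) ∨ (j : ℕ) + 1 = (i : ℕ) then a
      else 0)
    (v : Fin n → R) (i : Fin n) :
    A.mulVec v i = 2 * zeroExtend v (i + 1) + a * (zeroExtend v i + zeroExtend v (i + 2)) := by
  rw [← tridiagonal_mulVec a A hA _ (zeroExtend_zero v) (zeroExtend_last v)]
  simp only [zeroExtend_succ]

/-- A sequence with integral second differences that starts at `0` is linear modulo `ℤ`. -/
theorem exists_int_eq_nat_mul_add (n : ℕ) (h : ℕ → ℚ) (h0 : h 0 = 0)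
    (hh : ∀ k < n, ∃ t : ℤ, 2 * h (k + 1) - h k - h (k + 2) = t) :
    ∀ k ≤ n, (∃ t : ℤ, h k = k * h 1 + t) ∧ ∃ t : ℤ, h (k + 1) = (k + 1) * h 1 + t := by
  intro k
  induction k with
  | zero => exact fun _ => ⟨⟨0, by simp [h0]⟩, ⟨0, by simp⟩⟩
  | succ k ih =>
    intro hk
    obtain ⟨⟨s, hs⟩, ⟨t, ht⟩⟩ := ih (by omega)
    obtain ⟨r, hr⟩ := hh k (by omega)
    refine ⟨⟨t, by rw [ht]; push_cast; ring⟩, ⟨2 * t - s - r, ?_⟩⟩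
    push_cast
    linear_combination 2 * ht - hs - hr

/-- A concave sequence vanishing at both ends is nonnegative. -/
theorem nonneg_of_concave (n : ℕ) (h : ℕ → ℤ) (h0 : h 0 = 0) (hn : h (n + 1) = 0)
    (hh : ∀ k < n, 0 ≤ 2 * h (k + 1) - h k - h (k + 2)) : ∀ k ≤ n + 1, 0 ≤ h k := by
  intro k
  induction k with
  | zero => exact fun _ => h0.ge
  | succ k ih =>
    intro hk
    by_contra hneg
    push Not at hneg
    have h1 := ih (by omega)
    have key : ∀ p, k + p ≤ n → h (k + p + 1) < h (k + p) ∧ h (k + p + 1) < 0 := by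
      intro p
      induction p with
      | zero => exact fun _ => ⟨by simpa using by omega, by simpa using hneg⟩
      | succ p ihp =>
        intro hp
        have h2 := ihp (by omega)
        have h3 := hh (k + p) (by omega)
        rw [show k + (p + 1) = k + p + 1 by omega]
        rw [show k + p + 2 = k + p + 1 + 1 by omega] at h3
        omega
    have h4 := (key (n - k) (by omega)).2
    rw [show k + (n - k) + 1 = n + 1 by omega] at h4
    omega

/-- The discrete Dirichlet problem with a symmetric right-hand side of even length has a solution
with integral coefficients, whose two middle entries agree. -/
theorem exists_symmetric_solution {R : Type*} [CommRing R] [NoZeroDivisors R] [CharZero R]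
    (m : ℕ) (x : ℕ → R) (hx : ∀ i j, i + j + 1 = 2 * m → x i = x j) :
    ∃ y : ℕ → R, y 0 = 0 ∧ y (2 * m + 1) = 0 ∧ y (m + 1) = y m ∧
      ∀ k, 2 * y (k + 1) - y k - y (k + 2) = x k := by
  let S : ℕ → R := fun k => ∑ j ∈ Finset.range k, x j
  have hS : ∀ k, S (k + 1) = S k + x k := fun k => Finset.sum_range_succ _ _
  let y : ℕ → R := fun k => ∑ i ∈ Finset.range k, (S m - S i)
  have hy : ∀ k, y (k + 1) = y k + (S m - S k) := fun k => Finset.sum_range_succ _ _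
  have hsym : ∀ i ≤ 2 * m, S (2 * m - i) + S i = S (2 * m) := by
    intro i
    induction i with
    | zero => simp [S]
    | succ i ih =>
      intro hi
      have h1 := ih (by omega)
      have h2 := hS (2 * m - (i + 1))
      rw [show 2 * m - (i + 1) + 1 = 2 * m - i by omega,
        ← hx i (2 * m - (i + 1)) (by omega)] at h2
      rw [hS]
      linear_combination h1 - h2
  have hmid := hsym m (by omega)
  rw [show 2 * m - m = m by omega] at hmid
  refine ⟨y, by simp [y], ?_, by simp [hy], ?_⟩
  · have hr := Finset.sum_range_reflect (fun i => S m - S i) (2 * m + 1)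
    have hneg : ∑ i ∈ Finset.range (2 * m + 1), (S m - S (2 * m + 1 - 1 - i)) =
        -y (2 * m + 1) := by
      rw [← Finset.sum_neg_distrib]
      refine Finset.sum_congr rfl fun i hi => ?_
      have h1 := hsym i (by rw [Finset.mem_range] at hi; omega)
      rw [show 2 * m + 1 - 1 - i = 2 * m - i by omega]
      linear_combination hmid - h1
    rw [hneg] at hr
    have h2 : 2 * y (2 * m + 1) = 0 := by
      change -y (2 * m + 1) = y (2 * m + 1) at hr
      linear_combination -hr
    exact (mul_eq_zero.1 h2).resolve_left two_ne_zero
  · intro k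
    rw [show k + 2 = (k + 1) + 1 by omega, hy (k + 1), hy k, hS]
    ring

/-- A sequence vanishing at `0` and `2m+1` on which the signed Laplacian is integral is symmetric
modulo `ℤ`. -/
theorem exists_int_sub_reflect (m : ℕ) (g : ℕ → ℚ) (h0 : g 0 = 0) (hN : g (2 * m + 1) = 0)
    (hg : ∀ k < 2 * m, ∃ t : ℤ, 2 * g (k + 1) + g k + g (k + 2) = t) (i j : ℕ)
    (hij : i + j = 2 * m + 1) : ∃ t : ℤ, g i - g j = t := by
  have hlin := exists_int_eq_nat_mul_add (2 * m) (fun k => (-1) ^ k * g k) (by simp [h0]) (by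
    intro k hk
    obtain ⟨t, ht⟩ := hg k hk
    refine ⟨(-1) ^ (k + 1) * t, ?_⟩
    push_cast
    rw [← ht]
    ring)
  have hlin' : ∀ k ≤ 2 * m + 1, ∃ t : ℤ, (-1) ^ k * g k = k * -g 1 + t := by
    rintro (_ | k) hk
    · exact ⟨0, by simp [h0]⟩
    · obtain ⟨t, ht⟩ := (hlin k (by omega)).2
      exact ⟨t, by simpa using ht⟩
  obtain ⟨r, hr⟩ := hlin' (2 * m + 1) le_rfl
  obtain ⟨s, hs⟩ := hlin' i (by omega)
  obtain ⟨t, ht⟩ := hlin' j (by omega)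
  rw [hN, mul_zero] at hr
  have hj : ((-1 : ℚ)) ^ j = -(-1) ^ i := by
    have h1 : ((-1 : ℚ)) ^ (i + j) = -1 := by rw [hij]; exact Odd.neg_one_pow ⟨m, rfl⟩
    rw [pow_add] at h1
    rcases neg_one_pow_eq_or ℚ i with h | h <;> rw [h] at h1 ⊢ <;> linarith
  rw [hj] at ht
  have hijq : (i : ℚ) + j = (2 * m + 1 : ℕ) := by exact_mod_cast hij
  have hsum : (-1) ^ i * (g i - g j) = ((s + t - r : ℤ) : ℚ) := by
    push_cast at hijq hr ⊢
    linear_combination hs + ht - hr - hijq * g 1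
  rcases neg_one_pow_eq_or ℚ i with h | h <;> rw [h] at hsum
  · exact ⟨s + t - r, by linarith⟩
  · exact ⟨-(s + t - r), by push_cast at hsum ⊢; linarith⟩

/-- The integer part of the unsigned Laplacian of `g` is again the unsigned Laplacian of an
integral sequence, as soon as the signed Laplacian of `g` is integral. -/
theorem exists_int_solution_floor (m : ℕ) (g : ℕ → ℚ) (h0 : g 0 = 0) (hN : g (2 * m + 1) = 0)
    (hg : ∀ k < 2 * m, ∃ t : ℤ, 2 * g (k + 1) + g k + g (k + 2) = t) :
    ∃ z : ℕ → ℤ, z 0 = 0 ∧ z (2 * m + 1) = 0 ∧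
      ∀ k < 2 * m, 2 * z (k + 1) - z k - z (k + 2) = ⌊2 * g (k + 1) - g k - g (k + 2)⌋ := by
  have hsym := exists_int_sub_reflect m g h0 hN hg
  obtain ⟨y, hy0, hyN, hym, hy⟩ := exists_symmetric_solution m
    (fun k => Int.fract (2 * g (k + 1) - g k - g (k + 2))) (by
      intro i j hij
      obtain ⟨r, hr⟩ := hsym (i + 1) (j + 1) (by omega)
      obtain ⟨s, hs⟩ := hsym i (j + 2) (by omega)
      obtain ⟨t, ht⟩ := hsym (i + 2) j (by omega)
      refine Int.fract_eq_fract.2 ⟨2 * r - s - t, ?_⟩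
      push_cast
      linear_combination 2 * hr - hs - ht)
  have hdiff : ∀ k, 2 * (g (k + 1) - y (k + 1)) - (g k - y k) - (g (k + 2) - y (k + 2)) =
      (⌊2 * g (k + 1) - g k - g (k + 2)⌋ : ℤ) := by
    intro k
    have h1 := hy k
    have h2 := Int.floor_add_fract (2 * g (k + 1) - g k - g (k + 2))
    linarith
  have hlin := exists_int_eq_nat_mul_add (2 * m) (fun k => g k - y k) (by simp [h0, hy0])
    (fun k _ => ⟨_, hdiff k⟩)
  have h1 : ∃ t : ℤ, g 1 - y 1 = t := by
    obtain ⟨⟨s, hs⟩, ⟨t, ht⟩⟩ := hlin m (by omega)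
    obtain ⟨r, hr⟩ := hsym (m + 1) m (by omega)
    refine ⟨r - t + s, ?_⟩
    push_cast
    linear_combination hs - ht + hr - hym
  obtain ⟨q, hq⟩ := h1
  have hint : ∀ k, ∃ t : ℤ, k ≤ 2 * m + 1 → g k - y k = t := by
    rintro (_ | k)
    · exact ⟨0, by simp [h0, hy0]⟩
    · by_cases hk : k ≤ 2 * m
      · obtain ⟨t, ht⟩ := (hlin k hk).2
        refine ⟨(k + 1) * q + t, fun _ => ?_⟩
        simp only [hq] at ht
        push_cast
        exact ht
      · exact ⟨0, fun h => absurd h (by omega)⟩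
  choose z hz using hint
  refine ⟨z, ?_, ?_, ?_⟩
  · have := hz 0 (by omega)
    rw [h0, hy0, sub_zero] at this
    exact_mod_cast this.symm
  · have := hz (2 * m + 1) le_rfl
    rw [hN, hyN, sub_zero] at this
    exact_mod_cast this.symm
  · intro k hk
    have h := hdiff k
    rw [hz k (by omega), hz (k + 1) (by omega), hz (k + 2) (by omega)] at h
    exact_mod_cast h

theorem isUnit_det_tridiagonal {n : ℕ} (a : ℚ) (ha : a = 1 ∨ a = -1)
    (A : Matrix (Fin n) (Fin n) ℚ)
    (hA : ∀ i j : Fin n, A i j =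
      if i = j then 2
      else if (i : ℕ) + 1 = (j : ℕ) ∨ (j : ℕ) + 1 = (i : ℕ) then a
      else 0) : IsUnit A.det := by
  rw [← Matrix.isUnit_iff_isUnit_det, ← Matrix.mulVec_injective_iff_isUnit]
  refine (injective_iff_map_eq_zero A.mulVecLin).2 fun v hv => ?_
  have hv' : ∀ i, A.mulVec v i = 0 := fun i => congrFun hv i
  have haa : a * a = 1 := by rcases ha with rfl | rfl <;> norm_num
  have hrec : ∀ k < n, zeroExtend v (k + 2) = -2 * a * zeroExtend v (k + 1) - zeroExtend v k := by
    intro k hk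
    have h := tridiagonal_mulVec_zeroExtend a A hA v ⟨k, hk⟩
    rw [hv'] at h
    simp only at h
    linear_combination (-a) * h - (zeroExtend v k + zeroExtend v (k + 2)) * haa
  have hsol : ∀ k ≤ n, zeroExtend v k * (-a) = k * (-a) ^ k * zeroExtend v 1 ∧
      zeroExtend v (k + 1) = (k + 1) * (-a) ^ k * zeroExtend v 1 := by
    intro k
    induction k with
    | zero => exact fun _ => by simp [zeroExtend_zero]
    | succ k ih =>
      intro hk
      obtain ⟨h1, h2⟩ := ih (by omega)
      refine ⟨?_, ?_⟩
      · rw [h2, pow_succ]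
        push_cast
        ring
      · rw [show k + 1 + 1 = k + 2 by omega, hrec k (by omega), pow_succ]
        push_cast
        linear_combination (-2 * a) * h2 + a * h1 + zeroExtend v k * haa
  have hpow : (-a) ^ n ≠ 0 := pow_ne_zero _ (by rcases ha with rfl | rfl <;> norm_num)
  have h1 : zeroExtend v 1 = 0 := by
    have h := (hsol n le_rfl).2
    rw [zeroExtend_last] at h
    have hn : (n : ℚ) + 1 ≠ 0 := by positivity
    exact (mul_eq_zero.1 h.symm).resolve_left (mul_ne_zero hn hpow)
  funext i
  rw [← zeroExtend_succ v i, (hsol i i.isLt.le).2, h1, mul_zero, Pi.zero_apply]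

/-- Theorem `PetitDuality`: for the all-negative odd cycle `-C_{2m+1}`, the vector
`e = L·M⁻¹·𝟙` has integer entries and `c ↦ e + c` is a bijection from the set of
z-superstable configurations of the pair `(L, M)` onto the set of critical
configurations. -/
theorem stmt6 (m : ℕ) (hm : 1 ≤ m)
    (L M : Matrix (Fin (2 * m)) (Fin (2 * m)) ℤ)
    (hL : ∀ i j : Fin (2 * m), L i j =
      if i = j then 2
      else if (i : ℕ) + 1 = (j : ℕ) ∨ (j : ℕ) + 1 = (i : ℕ) then 1
      else 0)
    (hM : ∀ i j : Fin (2 * m), M i j =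
      if i = j then 2
      else if (i : ℕ) + 1 = (j : ℕ) ∨ (j : ℕ) + 1 = (i : ℕ) then -1
      else 0) :
    ∃ e : Fin (2 * m) → ℤ,
      (∀ i, (e i : ℚ) =
        (((L.map (Int.cast : ℤ → ℚ)) * (M.map (Int.cast : ℤ → ℚ))⁻¹).mulVec
          (fun _ => (1 : ℚ))) i) ∧
      Set.BijOn (fun c => e + c)
        {c | cfZSuperstable L M c} {c | cfCritical L M c} := by
  have hLq : ∀ i j : Fin (2 * m), (L.map (Int.cast : ℤ → ℚ)) i j =
      if i = j then 2
      else if (i : ℕ) + 1 = (j : ℕ) ∨ (j : ℕ) + 1 = (i : ℕ) then 1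
      else 0 := fun i j => by
    rw [Matrix.map_apply, hL]
    split_ifs <;> simp
  have hMq : ∀ i j : Fin (2 * m), (M.map (Int.cast : ℤ → ℚ)) i j =
      if i = j then 2
      else if (i : ℕ) + 1 = (j : ℕ) ∨ (j : ℕ) + 1 = (i : ℕ) then -1
      else 0 := fun i j => by
    rw [Matrix.map_apply, hM]
    split_ifs <;> simp
  have hLdet := isUnit_det_tridiagonal 1 (Or.inl rfl) _ hLq
  have hMdet := isUnit_det_tridiagonal (-1) (Or.inr rfl) _ hMq
  have hdiag : ∀ i, M i i = 2 := fun i => by simp [hM]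
  have hoff : ∀ i j, i ≠ j → M i j ≤ 0 := fun i j hij => by
    rw [hM, if_neg hij]
    split_ifs <;> simp
  have hpos : ∀ z : Fin (2 * m) → ℤ, (∀ i, 0 ≤ M.mulVec z i) → ∀ i, 0 ≤ z i := by
    intro z hz i
    rw [← zeroExtend_succ z i]
    refine nonneg_of_concave (2 * m) (zeroExtend z) (zeroExtend_zero z) (zeroExtend_last z)
      (fun k hk => ?_) _ (by omega)
    have h := hz ⟨k, hk⟩
    rw [tridiagonal_mulVec_zeroExtend (-1) M hM] at h
    simp only at h
    linarith
  have hfloor : ∀ c, ∃ z : Fin (2 * m) → ℤ, ∀ i, M.mulVec z i = ⌊cfCoord L M c i⌋ := by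
    intro c
    let v : Fin (2 * m) → ℚ := (L.map (Int.cast : ℤ → ℚ))⁻¹.mulVec (fun j => (c j : ℚ))
    have hLv : (L.map (Int.cast : ℤ → ℚ)).mulVec v = fun j => (c j : ℚ) := by
      rw [Matrix.mulVec_mulVec, Matrix.mul_nonsing_inv _ hLdet, Matrix.one_mulVec]
    have hco : cfCoord L M c = (M.map (Int.cast : ℤ → ℚ)).mulVec v := by
      rw [Matrix.mulVec_mulVec, cfCoord]
    obtain ⟨z, hz0, hzN, hz⟩ := exists_int_solution_floor m (zeroExtend v) (zeroExtend_zero v)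
      (zeroExtend_last v) (fun k hk => ⟨c ⟨k, hk⟩, by
        have h := congrFun hLv ⟨k, hk⟩
        rw [tridiagonal_mulVec_zeroExtend 1 _ hLq] at h
        simp only at h
        linarith⟩)
    refine ⟨fun i => z (i + 1), fun i => ?_⟩
    rw [tridiagonal_mulVec (-1) M hM z hz0 hzN, hco, tridiagonal_mulVec_zeroExtend (-1) _ hMq]
    have h := hz i i.isLt
    rw [show 2 * zeroExtend v (i + 1) + -1 * (zeroExtend v i + zeroExtend v (i + 2)) =
      2 * zeroExtend v (i + 1) - zeroExtend v i - zeroExtend v (i + 2) by ring, ← h]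
    ring
  obtain ⟨w, hw⟩ : ∃ w : Fin (2 * m) → ℤ, ∀ i, M.mulVec w i = 1 := by
    obtain ⟨y, hy0, hyN, -, hy⟩ := exists_symmetric_solution m (fun _ => (1 : ℤ)) (by simp)
    refine ⟨fun i => y (i + 1), fun i => ?_⟩
    rw [tridiagonal_mulVec (-1) M hM y hy0 hyN]
    linarith [hy i]
  have hss := cfZSuperstable_iff L M hLdet hpos hfloor
  have hcr := cfCritical_iff L M hLdet hdiag hoff hpos hfloor w hw
  have he : ∀ i, cfCoord L M (L.mulVec w) i = 1 := fun i => by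
    rw [cfCoord_mulVec L M hLdet, hw, Int.cast_one]
  refine ⟨L.mulVec w, ?_, ?_, ?_, ?_⟩
  · intro i
    have h1 : (fun _ => (1 : ℚ)) =
        (M.map (Int.cast : ℤ → ℚ)).mulVec (fun j => (w j : ℚ)) := by
      rw [← intCast_mulVec]
      simp [hw]
    rw [h1, Matrix.mulVec_mulVec, Matrix.mul_assoc, Matrix.nonsing_inv_mul _ hMdet,
      Matrix.mul_one, ← intCast_mulVec]
  · intro c hc
    refine (hcr _).2 fun i => ?_
    have h := (hss c).1 hc i
    rw [cfCoord_add, he]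
    constructor <;> linarith
  · exact fun a _ b _ hab => add_left_cancel hab
  · intro b hb
    refine ⟨b - L.mulVec w, (hss _).2 fun i => ?_, add_sub_cancel _ _⟩
    have h := (hcr b).1 hb i
    rw [cfCoord_sub_mulVec L M hLdet, hw, Int.cast_one]
    constructor <;> linarith
end

section
/- Let m ≥ 2, let n = 2m, and let B be the n×n integer matrix with B_{ii} = 3 for all i, B_{23} = B_{32} = −1, B_{ij} = 1 for all other pairs i ≠ j with i − j ≡ ±1 (mod n), and B_{ij} = 0 otherwise. Then the abelian group ℤⁿ/(image of B as a ℤ-linear map) is isomorphic to ℤ/ℓℤ × ℤ/ℓℤ, where ℓ = fib(2m−1) + fib(2m+1) is the (2m)-th Lucas number (fib denotes the Fibonacci sequence with fib 0 = 0, fib 1 = 1). -/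
open Matrix

namespace UnbalancedWheel

variable {A : Type*} [AddCommGroup A]

/-- Two-sided sequences satisfying the linear recurrence `f (k + 1) = -3 f k - f (k - 1)`. -/
def IsSol (f : ℤ → A) : Prop := ∀ k, f (k + 1) + 3 • f k + f (k - 1) = 0

theorem IsSol.eq_of_eq {f g : ℤ → A} (hf : IsSol f) (hg : IsSol g) (a : ℤ)
    (h₀ : f a = g a) (h₁ : f (a + 1) = g (a + 1)) (k : ℤ) : f k = g k := by
  suffices h : f k = g k ∧ f (k + 1) = g (k + 1) from h.1
  induction k using Int.inductionOn' (b := a) with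
  | zero => exact ⟨h₀, h₁⟩
  | succ k _ ih =>
    refine ⟨ih.2, ?_⟩
    have e₁ := hf (k + 1)
    have e₂ := hg (k + 1)
    rw [add_sub_cancel_right] at e₁ e₂
    rw [ih.1, ih.2, ← e₂] at e₁
    simpa using e₁
  | pred k _ ih =>
    rw [sub_add_cancel]
    refine ⟨?_, ih.1⟩
    have e₁ := hf k
    have e₂ := hg k
    rw [ih.1, ih.2, ← e₂] at e₁
    simpa using e₁

theorem IsSol.map {B : Type*} [AddCommGroup B] {f : ℤ → A} (hf : IsSol f) (φ : A →+ B) :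
    IsSol fun k => φ (f k) := by
  intro k
  simpa using congrArg φ (hf k)

theorem exists_isSol (a : ℤ) (x y : A) : ∃ f : ℤ → A, IsSol f ∧ f a = x ∧ f (a + 1) = y := by
  let s : ℤ → ℤ := fun k => (Polynomial.Chebyshev.S ℤ k).eval (-3)
  have hs : ∀ k, s (k + 2) = -3 * s (k + 1) - s k := fun k => by
    simp [s, Polynomial.Chebyshev.S_add_two]
  refine ⟨fun k => s (k - a - 1) • y - s (k - a - 2) • x, fun k => ?_, ?_, ?_⟩
  · have e₁ := hs (k - a - 2)
    have e₂ := hs (k - a - 3)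
    ring_nf at e₁ e₂ ⊢
    rw [e₁, e₂]
    module
  · simp [s]
  · simp [s]

/-- The Lucas number of index `2 * j`, written without truncated subtraction. -/
def evenLucas (j : ℕ) : ℤ := 2 * Nat.fib (2 * j + 1) - Nat.fib (2 * j)

theorem evenLucas_add_two (j : ℕ) :
    evenLucas (j + 2) = 3 * evenLucas (j + 1) - evenLucas j := by
  have h : ∀ i, Nat.fib (2 * j + (i + 2)) = Nat.fib (2 * j + i) + Nat.fib (2 * j + (i + 1)) :=
    fun i => Nat.fib_add_two
  have h₀ := h 0
  have h₁ := h 1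
  have h₂ := h 2
  have h₃ := h 3
  simp only [evenLucas, mul_add, Nat.reduceMul, add_assoc, Nat.reduceAdd, add_zero] at *
  lia

theorem evenLucas_eq {m : ℕ} (hm : 1 ≤ m) :
    evenLucas m = ((Nat.fib (2 * m - 1) + Nat.fib (2 * m + 1) : ℕ) : ℤ) := by
  obtain ⟨k, rfl⟩ := Nat.exists_eq_add_of_le' hm
  simp only [evenLucas, mul_add, Nat.reduceMul, show 2 * k + 2 + 1 = 2 * k + 1 + 2 by lia,
    Nat.fib_add_two]
  push_cast
  ring_nf

theorem IsSol.add_reflect {f : ℤ → A} (hf : IsSol f) (a : ℤ) (j : ℕ) :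
    f (a + j) + f (a - j) = ((-1) ^ j * evenLucas j) • f a := by
  induction j using Nat.twoStepInduction with
  | zero => simp [evenLucas, two_smul]
  | one =>
    have h := hf a
    have e : evenLucas 1 = 3 := by simp [evenLucas, Nat.fib_add_two]
    rw [e]
    push_cast
    linear_combination (norm := module) h
  | more j ih₀ ih₁ =>
    have h₁ := hf (a + j + 1)
    have h₂ := hf (a - j - 1)
    rw [evenLucas_add_two]
    push_cast at ih₀ ih₁ ⊢
    ring_nf at ih₀ ih₁ h₁ h₂ ⊢
    linear_combination (norm := module) h₁ + h₂ - 3 • ih₁ - ih₀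

theorem IsSol.antiperiodic_iff {f : ℤ → A} (hf : IsSol f) {m : ℕ} (hm : 1 ≤ m) (k : ℤ) :
    f (k + 2 * m) = -f k ↔ (Nat.fib (2 * m - 1) + Nat.fib (2 * m + 1)) • f (k + m) = 0 := by
  have h := hf.add_reflect (k + m) m
  rw [evenLucas_eq hm, add_sub_cancel_right, add_assoc, ← two_mul, mul_smul, natCast_zsmul] at h
  rw [← add_eq_zero_iff_eq_neg, h]
  rcases neg_one_pow_eq_or ℤ m with e | e <;> simp [e]

/-- The combination of the values of `w` given by column `j` of the Laplacian. -/
def columnSum (m : ℕ) (w : ℕ → A) (j : ℕ) : A :=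
  (if j = 1 then -w 2 else if j + 1 = 2 * m then w 0 else w (j + 1)) + 3 • w j +
    (if j = 2 then -w 1 else if j = 0 then w (2 * m - 1) else w (j - 1))

theorem sum_smul_eq_columnSum {m : ℕ} (hm : 2 ≤ m) (B : Matrix (Fin (2 * m)) (Fin (2 * m)) ℤ)
    (hB : ∀ i j : Fin (2 * m), B i j =
      if i = j then 3
      else if ((i : ℕ) + 1) % (2 * m) = (j : ℕ) ∨ ((j : ℕ) + 1) % (2 * m) = (i : ℕ) then
        (if ((i : ℕ) = 1 ∧ (j : ℕ) = 2) ∨ ((i : ℕ) = 2 ∧ (j : ℕ) = 1) then -1 else 1)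
      else 0) (w : ℕ → A) (j : Fin (2 * m)) :
    ∑ i, B i j • w i = columnSum m w j := by
  have hmod : ∀ i : Fin (2 * m), ((i : ℕ) + 1) % (2 * m) =
      if (i : ℕ) + 1 = 2 * m then 0 else (i : ℕ) + 1 := fun i => by
    split_ifs with h
    · rw [h, Nat.mod_self]
    · exact Nat.mod_eq_of_lt (by lia)
  simp only [hmod] at hB
  have hj := j.2
  let p : Fin (2 * m) := ⟨if (j : ℕ) + 1 = 2 * m then 0 else j + 1, by split_ifs <;> lia⟩
  let q : Fin (2 * m) := ⟨if (j : ℕ) = 0 then 2 * m - 1 else j - 1, by split_ifs <;> lia⟩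
  have hp : (p : ℕ) = if (j : ℕ) + 1 = 2 * m then 0 else (j : ℕ) + 1 := rfl
  have hq : (q : ℕ) = if (j : ℕ) = 0 then 2 * m - 1 else (j : ℕ) - 1 := rfl
  have hpj : p ≠ j := by grind
  have hpq : p ≠ q := by grind
  have hjq : j ≠ q := by grind
  have hsum : ∑ i, B i j • w i = B p j • w p + (B j j • w j + B q j • w q) := by
    rw [← Finset.sum_subset (Finset.subset_univ {p, j, q})]
    · rw [Finset.sum_insert (by simp [hpj, hpq]), Finset.sum_pair hjq]
    · intro i _ hi
      have : B i j = 0 := by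
        rw [hB]
        simp only [Finset.mem_insert, Finset.mem_singleton, not_or, Fin.ext_iff] at hi
        grind
      simp [this]
  have hBp : B p j = if (j : ℕ) = 1 then -1 else 1 := by grind
  have hBj : B j j = 3 := by simp [hB]
  have hBq : B q j = if (j : ℕ) = 2 then -1 else 1 := by grind
  rw [hsum, hBp, hBj, hBq, hp, hq, columnSum, add_assoc]
  congr 1
  · by_cases h : (j : ℕ) = 1
    · simp [h, show 2 ≠ 2 * m by lia]
    · by_cases hne : (j : ℕ) + 1 = 2 * m <;> simp [h, hne]
  · congr 1
    · norm_cast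
    · by_cases h : (j : ℕ) = 2
      · simp [h]
      · by_cases hne : (j : ℕ) = 0 <;> simp [h, hne]

/-- A sequence killed by all columns is, read from vertex `2` onwards, a solution of the
recurrence. -/
theorem exists_isSol_of_columnSum {m : ℕ} (hm : 2 ≤ m) (w : ℕ → A)
    (hw : ∀ j < 2 * m, columnSum m w j = 0) :
    ∃ f : ℤ → A, IsSol f ∧ (∀ k : ℕ, k + 2 < 2 * m → f k = w (k + 2)) ∧
      f (2 * m - 2) = w 0 ∧ f (2 * m - 1) = w 1 ∧
      f (0 + 2 * m) = -f 0 ∧ f (1 + 2 * m) = -f 1 := by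
  obtain ⟨f, hf, hf₀, hf₁⟩ := exists_isSol 0 (w 2) (w 3)
  rw [zero_add] at hf₁
  have hk : ∀ k : ℕ, k + 2 < 2 * m → f k = w (k + 2) := by
    intro k
    induction k using Nat.twoStepInduction with
    | zero => simp [hf₀]
    | one => simp [hf₁]
    | more k ih₀ ih₁ =>
      intro h
      have e₁ := hf (k + 1)
      have e₂ := hw (k + 3) (by lia)
      simp only [columnSum, show k + 3 ≠ 1 by lia, show k + 3 ≠ 2 by lia,
        show k + 3 ≠ 0 by lia, show k + 3 + 1 ≠ 2 * m by lia, if_false,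
        show k + 3 - 1 = k + 2 by lia] at e₂
      have i₀ := ih₀ (by lia)
      have i₁ := ih₁ (by lia)
      push_cast at i₁ ⊢
      rw [add_sub_cancel_right, i₀, i₁, ← e₂] at e₁
      simpa [add_assoc, one_add_one_eq_two] using e₁
  obtain ⟨t, rfl⟩ := Nat.exists_eq_add_of_le' hm
  have a₀ := hk (2 * t) (by lia)
  have a₁ := hk (2 * t + 1) (by lia)
  have r₀ := hf (2 * t + 1)
  have r₁ := hf (2 * t + 2)
  have r₂ := hf (2 * t + 3)
  have r₃ := hf (2 * t + 4)
  have c₀ := hw (2 * t + 3) (by lia)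
  have c₁ := hw 0 (by lia)
  have c₂ := hw 1 (by lia)
  have c₃ := hw 2 (by lia)
  simp [columnSum, mul_add] at c₀ c₁ c₂ c₃
  push_cast at a₀ a₁
  ring_nf at a₀ a₁ r₀ r₁ r₂ r₃ c₀ c₁ c₂ c₃
  have d₀ : f (2 + t * 2) = w 0 := by
    rw [a₀, a₁] at r₀
    linear_combination (norm := module) r₀ - c₀
  have d₁ : f (3 + t * 2) = w 1 := by
    rw [d₀, a₁] at r₁
    linear_combination (norm := module) r₁ - c₁
  have d₂ : f (4 + t * 2) = -f 0 := by
    rw [d₀, d₁] at r₂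
    rw [hf₀]
    linear_combination (norm := module) r₂ - c₂
  have d₃ : f (5 + t * 2) = -f 1 := by
    rw [d₁, d₂, hf₀] at r₃
    rw [hf₁]
    linear_combination (norm := module) r₃ + c₃
  refine ⟨f, hf, hk, ?_, ?_, ?_, ?_⟩
  · rw [← d₀]
    push_cast
    ring_nf
  · rw [← d₁]
    push_cast
    ring_nf
  · rw [← d₂]
    push_cast
    ring_nf
  · rw [← d₃]
    push_cast
    ring_nf

theorem IsSol.columnSum_eq_zero {m : ℕ} (hm : 2 ≤ m) {f : ℤ → A} (hf : IsSol f)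
    (hanti : ∀ k, f (k + 2 * m) = -f k) (j : ℕ) (hj : j < 2 * m) :
    columnSum m (fun i => f (if i < 2 then i + 2 * m - 2 else i - 2)) j = 0 := by
  obtain rfl | rfl | rfl | h : j = 0 ∨ j = 1 ∨ j = 2 ∨ 3 ≤ j := by lia
  · have h := hf (2 * m - 2)
    simp [columnSum, show 1 ≠ 2 * m by lia, show ¬ 2 * m - 1 < 2 by lia,
      show ((2 * m - 1 : ℕ) : ℤ) = 2 * m - 1 by lia]
    ring_nf at h ⊢
    exact h
  · have h := hf (2 * m - 1)
    have e := hanti 0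
    simp [columnSum]
    ring_nf at h e ⊢
    rw [← e, h]
  · have h := hf 0
    have e := hanti (-1)
    simp [columnSum, show 3 ≠ 2 * m by lia]
    ring_nf at h e ⊢
    rw [e, neg_neg]
    exact h
  · have hrec := hf (j - 2)
    obtain rfl | hlt : j = 2 * m - 1 ∨ j + 1 < 2 * m := by lia
    · simp [columnSum, show 2 * m - 1 ≠ 1 by lia, show 2 * m - 1 ≠ 2 by lia,
        show 2 * m - 1 ≠ 0 by lia, show 2 * m - 1 + 1 = 2 * m by lia,
        show ¬ 2 * m - 1 < 2 by lia, show ¬ 2 * m - 1 - 1 < 2 by lia,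
        show ((2 * m - 1 : ℕ) : ℤ) = 2 * m - 1 by lia,
        show ((2 * m - 1 - 1 : ℕ) : ℤ) = 2 * m - 2 by lia] at hrec ⊢
      ring_nf at hrec ⊢
      exact hrec
    · simp [columnSum, show j ≠ 1 by lia, show j ≠ 2 by lia, show j ≠ 0 by lia,
        show j + 1 ≠ 2 * m by lia, show ¬ j < 2 by lia, show ¬ j + 1 < 2 by lia,
        show ¬ j - 1 < 2 by lia, show ((j - 1 : ℕ) : ℤ) = j - 1 by lia]
      ring_nf at hrec ⊢
      exact hrec

end UnbalancedWheel

open UnbalancedWheel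

/-- Lemma `unbalancedevenwheel`: for `n = 2m` with `m ≥ 2`, the cokernel of the reduced
signed Laplacian `B` of the signed even wheel whose only positive cycle edge is
`{v₂, v₃}` (diagonal `3`, entries at positions (2,3) and (3,2) (1-based) equal `-1`, all
other cyclically adjacent entries `1`, rest `0`) is `ℤ_ℓ ⊕ ℤ_ℓ` where
`ℓ = fib(2m-1) + fib(2m+1)` is the `2m`-th Lucas number. -/
theorem stmt10 (m : ℕ) (hm : 2 ≤ m) (B : Matrix (Fin (2 * m)) (Fin (2 * m)) ℤ)
    (hB : ∀ i j : Fin (2 * m), B i j =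
      if i = j then 3
      else if ((i : ℕ) + 1) % (2 * m) = (j : ℕ) ∨ ((j : ℕ) + 1) % (2 * m) = (i : ℕ) then
        (if ((i : ℕ) = 1 ∧ (j : ℕ) = 2) ∨ ((i : ℕ) = 2 ∧ (j : ℕ) = 1) then -1 else 1)
      else 0) :
    Nonempty (((Fin (2 * m) → ℤ) ⧸ LinearMap.range (Matrix.toLin' B)) ≃+
      (ZMod (Nat.fib (2 * m - 1) + Nat.fib (2 * m + 1)) ×
        ZMod (Nat.fib (2 * m - 1) + Nat.fib (2 * m + 1)))) := by
  set l := Nat.fib (2 * m - 1) + Nat.fib (2 * m + 1) with hl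
  have hcol := fun {A : Type} [AddCommGroup A] => sum_smul_eq_columnSum (A := A) hm B hB
  let mk := (LinearMap.range (Matrix.toLin' B)).mkQ
  -- the solution formed by the classes of the standard basis vectors
  let w : ℕ → (Fin (2 * m) → ℤ) ⧸ LinearMap.range (Matrix.toLin' B) := fun i =>
    if h : i < 2 * m then mk (Pi.single ⟨i, h⟩ 1) else 0
  have hwi : ∀ i : Fin (2 * m), w i = mk (Pi.single i 1) := fun i => by simp [w]
  have hw : ∀ j < 2 * m, columnSum m w j = 0 := by
    intro j hj
    rw [← hcol w ⟨j, hj⟩]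
    simp only [hwi, ← map_smul, ← map_sum]
    refine (Submodule.Quotient.mk_eq_zero _).2 ⟨Pi.single ⟨j, hj⟩ 1, ?_⟩
    ext i
    simp [Finset.sum_apply, Pi.single_apply]
  obtain ⟨f, hf, hfw, hfw₀, hfw₁, hfn₀, hfn₁⟩ := exists_isSol_of_columnSum hm w hw
  have hfm₀ := (hf.antiperiodic_iff (by lia) _).1 hfn₀
  have hfm₁ := (hf.antiperiodic_iff (by lia) _).1 hfn₁
  rw [← hl] at hfm₀ hfm₁
  rw [zero_add] at hfm₀
  rw [add_comm] at hfm₁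
  -- the solution dual to the basis formed by the two central classes
  obtain ⟨g, hg, hgm₀, hgm₁⟩ :=
    exists_isSol (m : ℤ) ((1, 0) : ZMod l × ZMod l) ((0, 1) : ZMod l × ZMod l)
  have hganti : ∀ k, g (k + 2 * m) = -g k := fun k => by
    rw [hg.antiperiodic_iff (by lia)]
    ext <;> simp [← hl]
  let c : ℕ → ℤ := fun i => if i < 2 then i + 2 * m - 2 else i - 2
  have hfc : ∀ i < 2 * m, w i = f (c i) := by
    intro i hi
    obtain rfl | rfl | ⟨k, rfl⟩ : i = 0 ∨ i = 1 ∨ ∃ k, i = k + 2 := by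
      rcases i with _ | _ | k <;> simp
    · simp [c, hfw₀]
    · simp [c, ← hfw₁]
      ring_nf
    · simp [c, hfw k hi]
  let φ₀ : (Fin (2 * m) → ℤ) →ₗ[ℤ] ZMod l × ZMod l :=
    Fintype.linearCombination ℤ fun i : Fin (2 * m) => g (c i)
  have hφ₀ : LinearMap.range (Matrix.toLin' B) ≤ LinearMap.ker φ₀ := by
    rw [LinearMap.range_le_ker_iff]
    refine LinearMap.pi_ext' fun j => LinearMap.ext_ring ?_
    have h := hcol (fun i => g (c i)) j
    rw [hg.columnSum_eq_zero hm hganti j j.2] at h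
    simpa [φ₀, Fintype.linearCombination_apply] using h
  let φ := ((LinearMap.range (Matrix.toLin' B)).liftQ φ₀ hφ₀).toAddMonoidHom
  have hφw : ∀ i < 2 * m, φ (w i) = g (c i) := by
    intro i hi
    rw [hwi ⟨i, hi⟩]
    simp [φ, mk, φ₀, Fintype.linearCombination_apply_single]
  let ψ : ZMod l × ZMod l →+ _ :=
    (ZMod.lift l ⟨zmultiplesHom _ (f m), by simpa using hfm₀⟩).coprod
      (ZMod.lift l ⟨zmultiplesHom _ (f (m + 1)), by simpa using hfm₁⟩)
  have hψ : ∀ x y : ℤ, ψ (x, y) = x • f m + y • f (m + 1) := fun x y => by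
    simp [ψ, ZMod.lift_coe]
  have hψg : ∀ k, ψ (g k) = f k := by
    refine (hg.map ψ).eq_of_eq hf m ?_ ?_
    · simpa [hgm₀] using hψ 1 0
    · simpa [hgm₁] using hψ 0 1
  have hφf : ∀ k, φ (f k) = g k := by
    have hk : ∀ k : ℕ, k + 2 < 2 * m → φ (f k) = g k := fun k hk => by
      rw [hfw k hk, hφw _ hk]
      simp [c]
    refine (hf.map φ).eq_of_eq hg 0 (hk 0 (by lia)) (hk 1 (by lia))
  refine ⟨AddMonoidHom.toAddEquiv φ ψ ?_ ?_⟩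
  · have h : (ψ.comp φ).toIntLinearMap ∘ₗ mk = mk :=
      LinearMap.pi_ext' fun i => LinearMap.ext_ring <| by
        simp [← hwi, hfc i i.2, hφf, hψg]
    ext x
    obtain ⟨v, rfl⟩ := Submodule.mkQ_surjective _ x
    exact LinearMap.congr_fun h v
  · refine AddMonoidHom.ext fun ⟨x, y⟩ => ?_
    obtain ⟨x, rfl⟩ := ZMod.intCast_surjective x
    obtain ⟨y, rfl⟩ := ZMod.intCast_surjective y
    simp [hψ, hφf, hgm₀, hgm₁]
end
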